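/- If F = (f_1,…,f_n) is an S-M system on B, then F = 0 has at most one root in B: there is at most one point p ∈ B with f_1(p) = ⋯ = f_n(p) = 0. -/

import Mathlib

/-- The partial derivative `∂f/∂x_i` at `p`. -/
noncomputable def pd {m : ℕ} (f : (Fin m → ℝ) → ℝ) (i : Fin m) (p : Fin m → ℝ) : ℝ :=
  fderiv ℝ f p (Pi.single i 1)

/-- `f` is continuously differentiable on an open set containing `B`. -/
def C1On {m : ℕ} (f : (Fin m → ℝ) → ℝ) (B : Set (Fin m → ℝ)) : Prop :=
  ∃ U : Set (Fin m → ℝ), IsOpen U ∧ B ⊆ U ∧ ContDiffOn ℝ 1 f U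

/-- `F = (f_1,…,f_m)` is an S-M system on `B ⊆ ℝ^m`: for every `k ∈ {1,…,m}`,
every strictly increasing choice of `k` column indices `c`, and all points
`q_1,…,q_k ∈ B`, the `k × k` matrix with `(j,l)`-entry `(∂f_j/∂x_{c l})(q j)`
has nonzero determinant.  (`k` is represented as `k'+1` with `k'+1 ≤ m`.) -/
def SMSystem (m : ℕ) (f : Fin m → (Fin m → ℝ) → ℝ) (B : Set (Fin m → ℝ)) : Prop :=
  ∀ (k : ℕ) (hk : k + 1 ≤ m) (c : Fin (k+1) → Fin m), StrictMono c →
    ∀ q : Fin (k+1) → (Fin m → ℝ), (∀ j, q j ∈ B) →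
      (Matrix.of fun j l : Fin (k+1) => pd (f (Fin.castLE hk j)) (c l) (q j)).det ≠ 0

theorem C1On.differentiableAt {m : ℕ} {f : (Fin m → ℝ) → ℝ} {B : Set (Fin m → ℝ)}
    (hf : C1On f B) {x : Fin m → ℝ} (hx : x ∈ B) : DifferentiableAt ℝ f x := by
  obtain ⟨U, hU, hBU, hfU⟩ := hf
  exact (hfU.differentiableOn one_ne_zero).differentiableAt (hU.mem_nhds (hBU hx))

theorem fderiv_apply_eq_sum_pd {m : ℕ} (f : (Fin m → ℝ) → ℝ) (z v : Fin m → ℝ) :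
    fderiv ℝ f z v = ∑ i, pd f i z * v i := by
  conv_lhs => rw [pi_eq_sum_univ' v, map_sum]
  refine Finset.sum_congr rfl fun i _ => ?_
  rw [map_smul, smul_eq_mul, mul_comm]
  simp [pd]

/-- The mean value theorem on a convex set, in terms of partial derivatives. -/
theorem C1On.exists_sub_eq_sum_pd {m : ℕ} {f : (Fin m → ℝ) → ℝ} {B : Set (Fin m → ℝ)}
    (hf : C1On f B) (hB : Convex ℝ B) {p q : Fin m → ℝ} (hp : p ∈ B) (hq : q ∈ B) :
    ∃ z ∈ B, f q - f p = ∑ i, pd f i z * (q - p) i := by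
  obtain ⟨z, hz, h⟩ := domain_mvt
    (fun x hx => (hf.differentiableAt hx).hasFDerivAt.hasFDerivWithinAt) hB hp hq
  exact ⟨z, hB.segment_subset hp hq hz, h.trans (fderiv_apply_eq_sum_pd f z _)⟩

/-- An S-M system on a box `B` has at most one root in `B`. -/
theorem SMSystem.at_most_one_zero (n : ℕ) (a b : Fin (n+1) → ℝ)
    (hab : ∀ i, a i < b i) (f : Fin (n+1) → (Fin (n+1) → ℝ) → ℝ)
    (hC1 : ∀ j, C1On (f j) (Set.Icc a b))
    (hSM : SMSystem (n+1) f (Set.Icc a b)) :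
    ∀ p q : Fin (n+1) → ℝ, p ∈ Set.Icc a b → q ∈ Set.Icc a b →
      (∀ j, f j p = 0) → (∀ j, f j q = 0) → p = q := by
  intro p q hp hq hfp hfq
  choose z hz h using fun j => (hC1 j).exists_sub_eq_sum_pd (convex_Icc a b) hp hq
  have hdet := hSM n le_rfl id strictMono_id z hz
  refine (sub_eq_zero.mp (Matrix.eq_zero_of_mulVec_eq_zero hdet ?_)).symm
  ext j
  have hj := h j
  rw [hfp, hfq, sub_zero] at hj
  exact hj.symm
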